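/- Let 0 < α < 1/2 and α < β < 1, and let f : I × I → ℝ be Hölder continuous. Then the induced observable f_{Δ₀} belongs to L²(Δ₀, ν), i.e. ∫_{Δ₀} |f_{Δ₀}|² dν < ∞. -/

import Mathlib

open MeasureTheory Filter Set Topology

noncomputable section

/-- The Liverani–Saussol–Vaienti map `T_a` on `[0,1]`. -/
def lsv (a x : ℝ) : ℝ := if x ≤ 1 / 2 then x * (1 + (2 : ℝ) ^ a * x ^ a) else 2 * x - 1

/-- Random parameter selection: `α` on `[0,p₁)`, `β` on `[p₁,1]`. -/
def alphaOf (α β p₁ ω : ℝ) : ℝ := if ω < p₁ then α else β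

/-- The noise dynamics `φ` on `[0,1]`. -/
def phiMap (p₁ ω : ℝ) : ℝ := if ω < p₁ then ω / p₁ else (ω - p₁) / (1 - p₁)

/-- The skew product `S(x,ω) = (T_{α(ω)} x, φ ω)`. -/
def skewLSV (α β p₁ : ℝ) (p : ℝ × ℝ) : ℝ × ℝ :=
  (lsv (alphaOf α β p₁ p.2) p.1, phiMap p₁ p.2)

/-- The base of inducing, `Δ₀ = (1/2,1] × [0,1]`. -/
def Δ0 : Set (ℝ × ℝ) := Ioc (1 / 2 : ℝ) 1 ×ˢ Icc (0 : ℝ) 1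

/-- First return time of the skew product `S` to `Δ₀`. -/
def retTime (α β p₁ : ℝ) (p : ℝ × ℝ) : ℕ :=
  sInf {n : ℕ | 1 ≤ n ∧ (skewLSV α β p₁)^[n] p ∈ Δ0}

/-- The induced observable `f_{Δ₀}(x,ω) = Σ_{k<R(x,ω)} f(Sᵏ(x,ω))`. -/
def inducedObs (α β p₁ : ℝ) (f : ℝ × ℝ → ℝ) (p : ℝ × ℝ) : ℝ :=
  ∑ k ∈ Finset.range (retTime α β p₁ p), f ((skewLSV α β p₁)^[k] p)

/-- The half-open unit square, which the skew product maps into itself. -/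
def unitBox : Set (ℝ × ℝ) := Ioc (0 : ℝ) 1 ×ˢ Ico (0 : ℝ) 1

lemma lsv_of_le {a x : ℝ} (ha : 0 < a) (hx : 0 ≤ x) (hx' : x ≤ 1 / 2) :
    lsv a x = x + 2 ^ a * x ^ (1 + a) := by
  rw [lsv, if_pos hx', Real.rpow_add' hx (by linarith), Real.rpow_one]
  ring

lemma lsv_of_gt {a x : ℝ} (hx : 1 / 2 < x) : lsv a x = 2 * x - 1 := by
  rw [lsv, if_neg (not_le.2 hx)]

lemma lsv_half (a : ℝ) : lsv a (1 / 2) = 1 := by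
  rw [lsv, if_pos le_rfl, ← Real.mul_rpow (by norm_num) (by norm_num)]
  norm_num

lemma lsv_zero (a : ℝ) : lsv a 0 = 0 := by simp [lsv]

lemma lsv_strictMonoOn {a : ℝ} (ha : 0 < a) : StrictMonoOn (lsv a) (Icc 0 (1 / 2)) := by
  intro x hx y hy hxy
  rw [lsv_of_le ha hx.1 hx.2, lsv_of_le ha hy.1 hy.2]
  have h := Real.rpow_le_rpow hx.1 hxy.le (by linarith : 0 ≤ 1 + a)
  exact add_lt_add_of_lt_of_le hxy (mul_le_mul_of_nonneg_left h (by positivity))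

lemma lsv_convexOn {a : ℝ} (ha : 0 < a) : ConvexOn ℝ (Icc 0 (1 / 2)) (lsv a) := by
  have h : ConvexOn ℝ (Icc (0 : ℝ) (1 / 2)) fun x : ℝ => x + 2 ^ a * x ^ (1 + a) :=
    (convexOn_id (convex_Icc _ _)).add
      (((convexOn_rpow (by linarith : 1 ≤ 1 + a)).subset
        (fun x hx => hx.1) (convex_Icc _ _)).smul (by positivity : (0 : ℝ) ≤ 2 ^ a))
  exact h.congr fun x hx => (lsv_of_le ha hx.1 hx.2).symm

lemma lsv_continuousOn {a : ℝ} (ha : 0 < a) : ContinuousOn (lsv a) (Icc 0 (1 / 2)) := by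
  have h : ContinuousOn (fun x : ℝ => x + 2 ^ a * x ^ (1 + a)) (Icc 0 (1 / 2)) := by
    refine continuousOn_id.add (continuousOn_const.mul ?_)
    exact continuousOn_id.rpow_const fun x _ => Or.inr (by linarith)
  exact h.congr fun x hx => lsv_of_le ha hx.1 hx.2

lemma lsv_mem_Ioc {a x : ℝ} (ha : 0 < a) (hx : x ∈ Ioc (0 : ℝ) 1) : lsv a x ∈ Ioc (0 : ℝ) 1 := by
  rcases le_or_gt x (1 / 2) with h | h
  · constructor
    · rw [← lsv_zero a]
      exact lsv_strictMonoOn ha ⟨le_rfl, by norm_num⟩ ⟨hx.1.le, h⟩ hx.1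
    · rw [← lsv_half a]
      exact (lsv_strictMonoOn ha).monotoneOn ⟨hx.1.le, h⟩ ⟨by norm_num, le_rfl⟩ h
  · rw [lsv_of_gt h]
    constructor <;> linarith [hx.2]

lemma phiMap_mem_Ico {p₁ w : ℝ} (hp₁ : 0 < p₁) (hw : w ∈ Ico (0 : ℝ) 1) :
    phiMap p₁ w ∈ Ico (0 : ℝ) 1 := by
  have hw0 := hw.1
  have hw1 := hw.2
  unfold phiMap
  split_ifs with h
  · exact ⟨by positivity, by rwa [div_lt_one hp₁]⟩
  · have h1 : 0 < 1 - p₁ := by linarith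
    exact ⟨div_nonneg (by linarith) h1.le, by rw [div_lt_one h1]; linarith⟩

lemma alphaOf_pos {α β p₁ : ℝ} (hα : 0 < α) (hβ : 0 < β) (w : ℝ) : 0 < alphaOf α β p₁ w := by
  unfold alphaOf
  split_ifs <;> assumption

lemma skewLSV_mem_unitBox {α β p₁ : ℝ} (hα : 0 < α) (hβ : 0 < β) (hp₁ : 0 < p₁) {p : ℝ × ℝ}
    (hp : p ∈ unitBox) : skewLSV α β p₁ p ∈ unitBox :=
  ⟨lsv_mem_Ioc (alphaOf_pos hα hβ _) hp.1, phiMap_mem_Ico hp₁ hp.2⟩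

lemma iterate_skewLSV_mem_unitBox {α β p₁ : ℝ} (hα : 0 < α) (hβ : 0 < β) (hp₁ : 0 < p₁)
    {p : ℝ × ℝ} (hp : p ∈ unitBox) (n : ℕ) : (skewLSV α β p₁)^[n] p ∈ unitBox := by
  have h : MapsTo (skewLSV α β p₁) unitBox unitBox := fun q hq => skewLSV_mem_unitBox hα hβ hp₁ hq
  exact h.iterate n hp

lemma measurable_skewLSV (α β p₁ : ℝ) : Measurable (skewLSV α β p₁) := by
  unfold skewLSV alphaOf phiMap lsv
  refine Measurable.prodMk ?_ ?_
  · refine Measurable.ite (measurableSet_le measurable_fst measurable_const) ?_ (by fun_prop)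
    have h : Measurable fun p : ℝ × ℝ => if p.2 < p₁ then α else β :=
      Measurable.ite (measurableSet_lt measurable_snd measurable_const)
        measurable_const measurable_const
    fun_prop
  · exact Measurable.ite (measurableSet_lt measurable_snd measurable_const) (by fun_prop)
      (by fun_prop)

/-- Each inverse branch of the interval map is increasing and concave. -/
lemma exists_concave_inverse_branch {a : ℝ} (ha : 0 < a) (i : Bool) :
    ∃ G : ℝ → ℝ, MonotoneOn G (Icc 0 1) ∧ ConcaveOn ℝ (Icc 0 1) G ∧
      MapsTo G (Icc 0 1) (Icc 0 1) ∧
      ∀ u ∈ Icc (0 : ℝ) 1, ∀ v ∈ Icc (0 : ℝ) 1, ∀ x ∈ Ioc (0 : ℝ) 1,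
        (decide (x ≤ 1 / 2) = i ∧ lsv a x ∈ Ioc u v) ↔ x ∈ Ioc (G u) (G v) := by
  cases i with
  | false =>
    refine ⟨fun y => (y + 1) / 2, fun x _ y _ h => by dsimp; linarith, ?_, ?_, ?_⟩
    · refine ⟨convex_Icc _ _, fun x _ y _ s t _ _ hst => ?_⟩
      simp only [smul_eq_mul]
      obtain rfl : s = 1 - t := by linarith
      linarith
    · intro y hy
      constructor <;> dsimp <;> linarith [hy.1, hy.2]
    · intro u hu v hv x hx
      have hu0 := hu.1
      simp only [decide_eq_false_iff_not, not_le, mem_Ioc]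
      constructor
      · rintro ⟨h, h1, h2⟩
        rw [lsv_of_gt h] at h1 h2
        constructor <;> linarith
      · rintro ⟨h1, h2⟩
        have h : 1 / 2 < x := by linarith
        rw [lsv_of_gt h]
        exact ⟨h, by linarith, by linarith⟩
  | true =>
    have hsurj : ∀ y ∈ Icc (0 : ℝ) 1, ∃ x ∈ Icc (0 : ℝ) (1 / 2), lsv a x = y := by
      intro y hy
      have h := intermediate_value_Icc (by norm_num : (0 : ℝ) ≤ 1 / 2) (lsv_continuousOn ha)
      rw [lsv_zero, lsv_half a] at h
      exact h hy
    choose! G hG hTG using hsurj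
    have hmono := lsv_strictMonoOn ha
    refine ⟨G, ?_, ⟨convex_Icc _ _, ?_⟩, ?_, ?_⟩
    · intro x hx y hy h
      rwa [← hmono.le_iff_le (hG x hx) (hG y hy), hTG x hx, hTG y hy]
    · intro x hx y hy s t hs ht hst
      have hm := convex_Icc (0 : ℝ) 1 hx hy hs ht hst
      rw [← hmono.le_iff_le (convex_Icc (0 : ℝ) (1 / 2) (hG x hx) (hG y hy) hs ht hst) (hG _ hm),
        hTG _ hm]
      refine ((lsv_convexOn ha).2 (hG x hx) (hG y hy) hs ht hst).trans ?_
      rw [hTG x hx, hTG y hy]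
    · intro y hy
      exact ⟨(hG y hy).1, (hG y hy).2.trans (by norm_num)⟩
    · intro u hu v hv x hx
      simp only [decide_eq_true_eq, mem_Ioc]
      constructor
      · rintro ⟨h, h1, h2⟩
        have hx' : x ∈ Icc (0 : ℝ) (1 / 2) := ⟨hx.1.le, h⟩
        rw [← hmono.lt_iff_lt (hG u hu) hx', ← hmono.le_iff_le hx' (hG v hv), hTG u hu, hTG v hv]
        exact ⟨h1, h2⟩
      · rintro ⟨h1, h2⟩
        have hx' : x ∈ Icc (0 : ℝ) (1 / 2) := ⟨hx.1.le, h2.trans (hG v hv).2⟩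
        rw [← hmono.lt_iff_lt (hG u hu) hx', hTG u hu] at h1
        rw [← hmono.le_iff_le hx' (hG v hv), hTG v hv] at h2
        exact ⟨hx'.2, h1, h2⟩

/-- Each inverse branch of the noise map is affine. -/
lemma exists_affine_inverse_branch {p₁ : ℝ} (hp₁ : 0 < p₁) (hp₁' : p₁ < 1) (j : Bool) :
    ∃ r s : ℝ, 0 ≤ r ∧ 0 ≤ s ∧ r + s ≤ 1 ∧
      ∀ c ∈ Icc (0 : ℝ) 1, ∀ d ∈ Icc (0 : ℝ) 1, ∀ w ∈ Ico (0 : ℝ) 1,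
        (decide (w < p₁) = j ∧ phiMap p₁ w ∈ Ico c d) ↔ w ∈ Ico (r + s * c) (r + s * d) := by
  have hp₂ : 0 < 1 - p₁ := by linarith
  cases j with
  | false =>
    refine ⟨p₁, 1 - p₁, hp₁.le, hp₂.le, by linarith, fun c hc d hd w hw => ?_⟩
    have := mul_nonneg hp₂.le hc.1
    simp only [decide_eq_false_iff_not, mem_Ico]
    constructor
    · rintro ⟨h, h1, h2⟩
      rw [phiMap, if_neg h] at h1 h2
      rw [le_div_iff₀ hp₂] at h1
      rw [div_lt_iff₀ hp₂] at h2
      constructor <;> linarith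
    · rintro ⟨h1, h2⟩
      have h : ¬ w < p₁ := by linarith
      rw [phiMap, if_neg h, le_div_iff₀ hp₂, div_lt_iff₀ hp₂]
      exact ⟨h, by linarith, by linarith⟩
  | true =>
    refine ⟨0, p₁, le_rfl, hp₁.le, by linarith, fun c hc d hd w hw => ?_⟩
    have := mul_le_mul_of_nonneg_left hd.2 hp₁.le
    simp only [decide_eq_true_eq, mem_Ico]
    constructor
    · rintro ⟨h, h1, h2⟩
      rw [phiMap, if_pos h] at h1 h2
      rw [le_div_iff₀ hp₁] at h1
      rw [div_lt_iff₀ hp₁] at h2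
      constructor <;> linarith
    · rintro ⟨h1, h2⟩
      have h : w < p₁ := by linarith
      rw [phiMap, if_pos h, le_div_iff₀ hp₁, div_lt_iff₀ hp₁]
      exact ⟨h, by linarith, by linarith⟩

/-- The pair of branches used by the skew product at a point. -/
def branchCode (p₁ : ℝ) (p : ℝ × ℝ) : Bool × Bool := (decide (p.1 ≤ 1 / 2), decide (p.2 < p₁))

/-- The cylinder of points of the unit box whose first `n` branch codes are prescribed by `w`. -/
def itineraryCylinder (α β p₁ : ℝ) (n : ℕ) (w : ℕ → Bool × Bool) : Set (ℝ × ℝ) :=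
  {p | p ∈ unitBox ∧ ∀ k < n, branchCode p₁ ((skewLSV α β p₁)^[k] p) = w k}

lemma measurable_branchCode (p₁ : ℝ) : Measurable (branchCode p₁) := by
  refine Measurable.prodMk (measurable_to_bool ?_) (measurable_to_bool ?_)
  · have h : MeasurableSet {p : ℝ × ℝ | p.1 ≤ 1 / 2} :=
      measurableSet_le measurable_fst measurable_const
    convert h using 1
    ext p
    simp
  · have h : MeasurableSet {p : ℝ × ℝ | p.2 < p₁} :=
      measurableSet_lt measurable_snd measurable_const
    convert h using 1
    ext p
    simp

lemma measurableSet_unitBox : MeasurableSet unitBox := measurableSet_Ioc.prod measurableSet_Ico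

lemma measurableSet_itineraryCylinder (α β p₁ : ℝ) (n : ℕ) (w : ℕ → Bool × Bool) :
    MeasurableSet (itineraryCylinder α β p₁ n w) := by
  have h : itineraryCylinder α β p₁ n w =
      unitBox ∩ ⋂ k, ⋂ _ : k < n, (fun p => branchCode p₁ ((skewLSV α β p₁)^[k] p)) ⁻¹' {w k} := by
    ext p
    simp [itineraryCylinder]
  rw [h]
  refine measurableSet_unitBox.inter (.iInter fun k => .iInter fun _ => ?_)
  exact ((measurable_branchCode p₁).comp ((measurable_skewLSV α β p₁).iterate k))
    (measurableSet_singleton _)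

/-- The distribution of the `n`-th image of a cylinder is a product whose first factor has a
concave distribution function. -/
lemma exists_concave_volume_cylinder {α β p₁ : ℝ} (hα : 0 < α) (hβ : 0 < β) (hp₁ : 0 < p₁)
    (hp₁' : p₁ < 1) (n : ℕ) (w : ℕ → Bool × Bool) :
    ∃ (F : ℝ → ℝ) (P : ℝ), MonotoneOn F (Icc 0 1) ∧ ConcaveOn ℝ (Icc 0 1) F ∧ 0 ≤ P ∧
      ∀ a b c d : ℝ, 0 ≤ a → a ≤ b → b ≤ 1 → 0 ≤ c → c ≤ d → d ≤ 1 →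
        volume (itineraryCylinder α β p₁ n w ∩ (skewLSV α β p₁)^[n] ⁻¹' (Ioc a b ×ˢ Ico c d)) =
          ENNReal.ofReal ((F b - F a) * (P * (d - c))) := by
  induction n with
  | zero =>
    refine ⟨id, 1, monotone_id.monotoneOn _, concaveOn_id (convex_Icc _ _), zero_le_one, ?_⟩
    intro a b c d ha hab hb hc hcd hd
    have h : itineraryCylinder α β p₁ 0 w ∩ (skewLSV α β p₁)^[0] ⁻¹' (Ioc a b ×ˢ Ico c d) =
        Ioc a b ×ˢ Ico c d := by
      ext p
      simp only [itineraryCylinder, unitBox, mem_inter_iff, mem_ofPred_eq, mem_prod, mem_Ioc, mem_Ico,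
        mem_preimage, Function.iterate_zero, id]
      constructor
      · rintro ⟨_, h⟩
        exact h
      · rintro ⟨⟨h1, h2⟩, h3, h4⟩
        refine ⟨⟨⟨⟨?_, ?_⟩, ?_, ?_⟩, ?_⟩, ⟨h1, h2⟩, h3, h4⟩ <;> first | linarith | (intro k hk; omega)
    rw [h, Measure.volume_eq_prod, Measure.prod_prod, Real.volume_Ioc, Real.volume_Ico,
      ← ENNReal.ofReal_mul (by linarith)]
    simp
  | succ n ih =>
    obtain ⟨F, P, hFm, hFc, hP, hF⟩ := ih
    obtain ⟨G, hGm, hGc, hGI, hG⟩ := exists_concave_inverse_branch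
      (a := if (w n).2 then α else β) (by split_ifs <;> assumption) (w n).1
    obtain ⟨r, s, hr, hs, hrs, hrs'⟩ := exists_affine_inverse_branch hp₁ hp₁' (w n).2
    refine ⟨F ∘ G, P * s, hFm.comp hGm hGI, ⟨convex_Icc _ _, ?_⟩, by positivity, ?_⟩
    · intro x hx y hy t u ht hu htu
      refine (hFc.2 (hGI hx) (hGI hy) ht hu htu).trans ?_
      exact hFm (convex_Icc (0 : ℝ) 1 (hGI hx) (hGI hy) ht hu htu)
        (hGI (convex_Icc (0 : ℝ) 1 hx hy ht hu htu)) (hGc.2 hx hy ht hu htu)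
    · intro a b c d ha hab hb hc hcd hd
      have haI : a ∈ Icc (0 : ℝ) 1 := ⟨ha, hab.trans hb⟩
      have hbI : b ∈ Icc (0 : ℝ) 1 := ⟨ha.trans hab, hb⟩
      have hcI : c ∈ Icc (0 : ℝ) 1 := ⟨hc, hcd.trans hd⟩
      have hdI : d ∈ Icc (0 : ℝ) 1 := ⟨hc.trans hcd, hd⟩
      have key : ∀ q ∈ unitBox, (branchCode p₁ q = w n ∧
          skewLSV α β p₁ q ∈ Ioc a b ×ˢ Ico c d) ↔
          q ∈ Ioc (G a) (G b) ×ˢ Ico (r + s * c) (r + s * d) := by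
        intro q hq
        rw [mem_prod (s := Ioc (G a) (G b)), ← hG a haI b hbI q.1 hq.1, ← hrs' c hcI d hdI q.2 hq.2]
        have hα' : decide (q.2 < p₁) = (w n).2 →
            alphaOf α β p₁ q.2 = if (w n).2 then α else β := by
          intro h
          rw [← h]
          simp [alphaOf]
        simp only [branchCode, Prod.ext_iff, skewLSV, mem_prod]
        constructor
        · rintro ⟨⟨h1, h2⟩, h3, h4⟩
          rw [hα' h2] at h3
          exact ⟨⟨h1, h3⟩, h2, h4⟩
        · rintro ⟨⟨h1, h3⟩, h2, h4⟩
          rw [hα' h2]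
          exact ⟨⟨h1, h2⟩, h3, h4⟩
      have h : itineraryCylinder α β p₁ (n + 1) w ∩ (skewLSV α β p₁)^[n + 1] ⁻¹' (Ioc a b ×ˢ Ico c d) =
          itineraryCylinder α β p₁ n w ∩ (skewLSV α β p₁)^[n] ⁻¹'
            (Ioc (G a) (G b) ×ˢ Ico (r + s * c) (r + s * d)) := by
        ext p
        simp only [itineraryCylinder, mem_inter_iff, mem_ofPred_eq, mem_preimage,
          Function.iterate_succ_apply']
        constructor
        · rintro ⟨⟨hp, hw⟩, hS⟩
          exact ⟨⟨hp, fun k hk => hw k (by omega)⟩,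
            (key _ (iterate_skewLSV_mem_unitBox hα hβ hp₁ hp n)).1 ⟨hw n (by omega), hS⟩⟩
        · rintro ⟨⟨hp, hw⟩, hS⟩
          obtain ⟨h1, h2⟩ := (key _ (iterate_skewLSV_mem_unitBox hα hβ hp₁ hp n)).2 hS
          refine ⟨⟨hp, fun k hk => ?_⟩, h2⟩
          rcases Nat.lt_succ_iff_lt_or_eq.1 hk with hk | rfl
          · exact hw k hk
          · exact h1
      have hsd : s * d ≤ s := mul_le_of_le_one_right hs hd
      have hscd := mul_le_mul_of_nonneg_left hcd hs
      have hsc := mul_nonneg hs hc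
      rw [h, hF _ _ _ _ (hGI haI).1 (hGm haI hbI hab) (hGI hbI).2 (by linarith) (by linarith)
        (by linarith)]
      simp only [Function.comp_apply]
      congr 1
      ring

/-- Bounded distortion: on the right half of the box, the image of a cylinder has at most twice its
average density. -/
lemma volume_cylinder_inter_le {α β p₁ : ℝ} (hα : 0 < α) (hβ : 0 < β) (hp₁ : 0 < p₁)
    (hp₁' : p₁ < 1) (n : ℕ) (w : ℕ → Bool × Bool) {a b c d : ℝ} (ha : 1 / 2 ≤ a) (hab : a ≤ b)
    (hb : b ≤ 1) (hc : 0 ≤ c) (hcd : c ≤ d) (hd : d ≤ 1) :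
    volume (itineraryCylinder α β p₁ n w ∩ (skewLSV α β p₁)^[n] ⁻¹' (Ioc a b ×ˢ Ico c d)) ≤
      2 * volume (Ioc a b ×ˢ Ico c d) * volume (itineraryCylinder α β p₁ n w) := by
  obtain ⟨F, P, hFm, hFc, hP, hF⟩ := exists_concave_volume_cylinder hα hβ hp₁ hp₁' n w
  have hfull : itineraryCylinder α β p₁ n w =
      itineraryCylinder α β p₁ n w ∩ (skewLSV α β p₁)^[n] ⁻¹' (Ioc 0 1 ×ˢ Ico 0 1) := by
    refine (inter_eq_left.2 fun p hp => ?_).symm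
    exact iterate_skewLSV_mem_unitBox hα hβ hp₁ hp.1 n
  have hvol := hF 0 1 0 1 le_rfl zero_le_one le_rfl le_rfl zero_le_one le_rfl
  rw [← hfull] at hvol
  have haI : a ∈ Icc (0 : ℝ) 1 := ⟨by linarith, by linarith⟩
  have hbI : b ∈ Icc (0 : ℝ) 1 := ⟨by linarith, by linarith⟩
  have h0I : (0 : ℝ) ∈ Icc (0 : ℝ) 1 := ⟨le_rfl, zero_le_one⟩
  have h1I : (1 : ℝ) ∈ Icc (0 : ℝ) 1 := ⟨zero_le_one, le_rfl⟩
  have hFa : F a ≤ F 1 := hFm haI h1I haI.2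
  have hF0a : F 0 ≤ F a := hFm h0I haI haI.1
  have hslope : F b - F a ≤ 2 * (b - a) * (F 1 - F 0) := by
    rcases hab.eq_or_lt with rfl | hlt
    · simp
    · have h := hFc.slope_anti_adjacent h0I hbI (by linarith : 0 < a) hlt
      rw [sub_zero, div_le_div_iff₀ (by linarith) (by linarith)] at h
      have hFab : F a ≤ F b := hFm haI hbI hab
      have h2 : (F a - F 0) * (b - a) ≤ (F 1 - F 0) * (b - a) :=
        mul_le_mul_of_nonneg_right (by linarith) (by linarith)
      have h3 : (F b - F a) * (1 / 2) ≤ (F b - F a) * a :=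
        mul_le_mul_of_nonneg_left ha (by linarith)
      linarith
  rw [hvol, hF a b c d haI.1 hab hb hc hcd hd, Measure.volume_eq_prod, Measure.prod_prod,
    Real.volume_Ioc, Real.volume_Ico, ← ENNReal.ofReal_mul (by linarith),
    show (2 : ENNReal) = ENNReal.ofReal 2 by simp, ← ENNReal.ofReal_mul (by norm_num),
    ← ENNReal.ofReal_mul (mul_nonneg (by norm_num) (mul_nonneg (by linarith) (by linarith)))]
  refine ENNReal.ofReal_le_ofReal ?_
  have h := mul_le_mul_of_nonneg_right hslope (mul_nonneg hP (by linarith : 0 ≤ d - c))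
  linarith

/-- The left branch separates points on it. -/
lemma lsv_sub_ge {a x y : ℝ} (ha : 0 < a) (ha' : a ≤ 1) (hx : 0 ≤ x) (hxy : x ≤ y)
    (hy : y ≤ 1 / 2) : (y - x) * (1 + 2 * (y - x)) ≤ lsv a y - lsv a x := by
  rw [lsv_of_le ha hx (hxy.trans hy), lsv_of_le ha (hx.trans hxy) hy]
  have hd : 0 ≤ y - x := by linarith
  have h1 : (y - x) ^ (1 + a) + x ^ (1 + a) ≤ y ^ (1 + a) := by
    have h := Real.add_rpow_le_rpow_add hd hx (by linarith : 1 ≤ 1 + a)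
    rwa [sub_add_cancel] at h
  have h2 : (y - x) * (2 * (y - x)) ≤ 2 ^ a * (y - x) ^ (1 + a) := by
    rw [Real.rpow_add' hd (by linarith), Real.rpow_one, mul_left_comm (2 ^ a),
      ← Real.mul_rpow (by norm_num) hd]
    refine mul_le_mul_of_nonneg_left ?_ hd
    exact Real.self_le_rpow_of_le_one (by linarith) (by linarith) ha'
  have h3 := mul_le_mul_of_nonneg_left h1 (by positivity : (0 : ℝ) ≤ 2 ^ a)
  linarith

lemma abs_sub_mul_le_abs_lsv_sub {a x y : ℝ} (ha : 0 < a) (ha' : a ≤ 1) (hx : x ∈ Ioc (0 : ℝ) 1)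
    (hy : y ∈ Ioc (0 : ℝ) 1) (hxy : x ≤ 1 / 2 ↔ y ≤ 1 / 2) :
    |x - y| * (1 + 2 * |x - y|) ≤ |lsv a x - lsv a y| := by
  wlog h : x ≤ y generalizing x y
  · rw [abs_sub_comm x, abs_sub_comm (lsv a x)]
    exact this hy hx hxy.symm (le_of_not_ge h)
  rw [abs_sub_comm x, abs_sub_comm (lsv a x), abs_of_nonneg (sub_nonneg.2 h)]
  by_cases hy' : y ≤ 1 / 2
  · exact (lsv_sub_ge ha ha' hx.1.le h hy').trans (le_abs_self _)
  · have hx' := mt hxy.1 hy'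
    rw [not_le] at hx' hy'
    refine le_trans ?_ (le_abs_self _)
    rw [lsv_of_gt hx', lsv_of_gt hy']
    nlinarith [hy.2]

lemma abs_sub_le_mul_abs_phiMap_sub {p₁ x y : ℝ} (hp₁ : 0 < p₁) (hp₁' : p₁ < 1)
    (hxy : x < p₁ ↔ y < p₁) : |x - y| ≤ max p₁ (1 - p₁) * |phiMap p₁ x - phiMap p₁ y| := by
  have hp₂ : 0 < 1 - p₁ := by linarith
  unfold phiMap
  by_cases h : x < p₁
  · rw [if_pos h, if_pos (hxy.1 h), ← sub_div, abs_div, abs_of_pos hp₁]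
    calc |x - y| = p₁ * (|x - y| / p₁) := by field_simp
      _ ≤ _ := mul_le_mul_of_nonneg_right (le_max_left _ _) (by positivity)
  · rw [if_neg h, if_neg (mt hxy.2 h), ← sub_div, abs_div, abs_of_pos hp₂, sub_sub_sub_cancel_right]
    calc |x - y| = (1 - p₁) * (|x - y| / (1 - p₁)) := by field_simp
      _ ≤ _ := mul_le_mul_of_nonneg_right (le_max_right _ _) (by positivity)

/-- Points with the same itinerary of length `n` are uniformly close. -/
lemma abs_sub_le_of_same_itinerary {α β p₁ : ℝ} (hα : 0 < α) (hα' : α ≤ 1) (hβ : 0 < β)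
    (hβ' : β ≤ 1) (hp₁ : 0 < p₁) (hp₁' : p₁ < 1) (n : ℕ) {p q : ℝ × ℝ} (hp : p ∈ unitBox)
    (hq : q ∈ unitBox) (h : ∀ k < n, branchCode p₁ ((skewLSV α β p₁)^[k] p) =
      branchCode p₁ ((skewLSV α β p₁)^[k] q)) :
    |p.1 - q.1| ≤ 1 / ((n : ℝ) + 1) ∧ |p.2 - q.2| ≤ max p₁ (1 - p₁) ^ n := by
  induction n generalizing p q with
  | zero =>
    obtain ⟨⟨h1, h2⟩, h3, h4⟩ := hp
    obtain ⟨⟨h5, h6⟩, h7, h8⟩ := hq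
    simp only [CharP.cast_eq_zero, zero_add, div_one, pow_zero, abs_le]
    exact ⟨⟨by linarith, by linarith⟩, by linarith, by linarith⟩
  | succ n ih =>
    obtain ⟨ih1, ih2⟩ := ih (skewLSV_mem_unitBox hα hβ hp₁ hp) (skewLSV_mem_unitBox hα hβ hp₁ hq)
      fun k hk => by simpa only [← Function.iterate_succ_apply] using h (k + 1) (by omega)
    have h0 := h 0 (by omega)
    simp only [branchCode, Function.iterate_zero, id, Prod.mk.injEq] at h0
    have hc1 := decide_eq_decide.1 h0.1
    have hc2 := decide_eq_decide.1 h0.2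
    have hαβ : alphaOf α β p₁ p.2 = alphaOf α β p₁ q.2 := by simp only [alphaOf, hc2]
    simp only [skewLSV] at ih1 ih2
    rw [hαβ] at ih1
    have hle : alphaOf α β p₁ q.2 ≤ 1 := by unfold alphaOf; split_ifs <;> assumption
    constructor
    · have hd := (abs_sub_mul_le_abs_lsv_sub (alphaOf_pos hα hβ q.2) hle hp.1 hq.1 hc1).trans ih1
      set t := |p.1 - q.1|
      by_contra! ht
      push_cast at ht
      have hn : (0 : ℝ) < n + 1 := by positivity
      rw [le_div_iff₀ hn] at hd
      rw [div_lt_iff₀ (by positivity)] at ht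
      have hn1 : (1 : ℝ) ≤ n + 1 := by linarith [(n.cast_nonneg : (0 : ℝ) ≤ n)]
      have ht0 : 0 < t := by
        by_contra! h
        nlinarith
      have h1 : 2 * t * (n + 1) < 1 := by
        refine lt_of_mul_lt_mul_left ?_ ht0.le
        linarith
      have h2 : 2 * t * 1 ≤ 2 * t * (n + 1) := mul_le_mul_of_nonneg_left hn1 (by linarith)
      linarith
    · refine (abs_sub_le_mul_abs_phiMap_sub hp₁ hp₁' hc2).trans ?_
      rw [pow_succ']
      exact mul_le_mul_of_nonneg_left ih2 (le_max_of_le_left hp₁.le)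

/-- A finite absolutely continuous measure is approximated, uniformly on all sets, by continuous
compactly supported densities. -/
lemma exists_continuous_density_approx {ν : Measure (ℝ × ℝ)} [IsFiniteMeasure ν]
    (hac : ν ≪ volume) {ε : ENNReal} (hε : ε ≠ 0) :
    ∃ g : ℝ × ℝ → ℝ, HasCompactSupport g ∧ Continuous g ∧
      (∀ E, MeasurableSet E → ν E ≤ (∫⁻ p in E, ‖g p‖ₑ) + ε) ∧ ∫⁻ p, ‖g p‖ₑ ≤ ν univ + ε := by
  have hint : Integrable (fun p => (ν.rnDeriv volume p).toReal) volume :=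
    Measure.integrable_toReal_rnDeriv
  obtain ⟨g, hgs, hg, hgc, -⟩ := hint.exists_hasCompactSupport_lintegral_sub_le hε
  have henorm : ∀ᵐ p ∂(volume : Measure (ℝ × ℝ)),
      ‖(ν.rnDeriv volume p).toReal‖ₑ = ν.rnDeriv volume p := by
    filter_upwards [Measure.rnDeriv_lt_top ν volume] with p hp
    rw [Real.enorm_of_nonneg ENNReal.toReal_nonneg, ENNReal.ofReal_toReal hp.ne]
  have hν : ∀ E, MeasurableSet E → ν E = ∫⁻ p in E, ‖(ν.rnDeriv volume p).toReal‖ₑ := by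
    intro E _
    rw [lintegral_congr_ae (ae_restrict_of_ae henorm), Measure.setLIntegral_rnDeriv hac]
  have hgm : Measurable fun p => ‖g p‖ₑ := hgc.measurable.enorm
  have hdm : Measurable fun p => ‖(ν.rnDeriv volume p).toReal - g p‖ₑ :=
    ((Measure.measurable_rnDeriv ν volume).ennreal_toReal.sub hgc.measurable).enorm
  refine ⟨g, hgs, hgc, fun E hE => ?_, ?_⟩
  · calc ν E = ∫⁻ p in E, ‖(ν.rnDeriv volume p).toReal‖ₑ := hν E hE
      _ ≤ ∫⁻ p in E, (‖g p‖ₑ + ‖(ν.rnDeriv volume p).toReal - g p‖ₑ) := by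
        refine lintegral_mono fun p => ?_
        simpa using enorm_add_le (g p) ((ν.rnDeriv volume p).toReal - g p)
      _ = (∫⁻ p in E, ‖g p‖ₑ) + ∫⁻ p in E, ‖(ν.rnDeriv volume p).toReal - g p‖ₑ :=
        lintegral_add_left hgm _
      _ ≤ _ := by gcongr; exact (setLIntegral_le_lintegral _ _).trans hg
  · calc ∫⁻ p, ‖g p‖ₑ
        ≤ ∫⁻ p, (‖(ν.rnDeriv volume p).toReal‖ₑ + ‖(ν.rnDeriv volume p).toReal - g p‖ₑ) := by
          refine lintegral_mono fun p => ?_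
          simpa using enorm_sub_le (a := (ν.rnDeriv volume p).toReal)
            (b := (ν.rnDeriv volume p).toReal - g p)
      _ = (∫⁻ p, ‖(ν.rnDeriv volume p).toReal‖ₑ)
          + ∫⁻ p, ‖(ν.rnDeriv volume p).toReal - g p‖ₑ := lintegral_add_right _ hdm
      _ ≤ _ := by
        rw [← setLIntegral_univ fun p => ‖(ν.rnDeriv volume p).toReal‖ₑ, ← hν univ .univ]
        gcongr

/-- Extension of a finite word by an arbitrary letter. -/
def extendWord {n : ℕ} (w : Fin n → Bool × Bool) (k : ℕ) : Bool × Bool :=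
  if h : k < n then w ⟨k, h⟩ else (true, true)

lemma iUnion_itineraryCylinder (α β p₁ : ℝ) (n : ℕ) :
    ⋃ w : Fin n → Bool × Bool, itineraryCylinder α β p₁ n (extendWord w) = unitBox := by
  ext p
  simp only [mem_iUnion, itineraryCylinder, mem_ofPred_eq]
  constructor
  · rintro ⟨_, h, _⟩
    exact h
  · intro h
    exact ⟨fun k => branchCode p₁ ((skewLSV α β p₁)^[k] p), h,
      fun k hk => by simp [extendWord, hk]⟩

lemma pairwise_disjoint_itineraryCylinder (α β p₁ : ℝ) (n : ℕ) :
    Pairwise (Function.onFun Disjoint fun w : Fin n → Bool × Bool =>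
      itineraryCylinder α β p₁ n (extendWord w)) := by
  intro w w' hne
  refine Set.disjoint_left.2 fun p hp hp' => hne (funext fun k => ?_)
  have h := (hp.2 k k.2).symm.trans (hp'.2 k k.2)
  simpa [extendWord] using h

lemma unitBox_ae_eq : (Icc (0 : ℝ) 1 ×ˢ Icc (0 : ℝ) 1 : Set (ℝ × ℝ)) =ᵐ[volume] unitBox := by
  rw [Measure.volume_eq_prod]
  exact Measure.set_prod_ae_eq Ioc_ae_eq_Icc.symm Ico_ae_eq_Icc.symm

lemma measure_iterate_preimage {X : Type*} [MeasurableSpace X] {ν : Measure X} {S : X → X}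
    (hS : Measurable S) (hinv : ∀ A, MeasurableSet A → ν (S ⁻¹' A) = ν A) (n : ℕ) {A : Set X}
    (hA : MeasurableSet A) : ν (S^[n] ⁻¹' A) = ν A := by
  have h : MeasurePreserving S ν ν := ⟨hS, Measure.ext fun A hA => by
    rw [Measure.map_apply hS hA, hinv A hA]⟩
  exact (h.iterate n).measure_preimage hA.nullMeasurableSet

/-- An absolutely continuous invariant probability measure has density at most `2` on rectangles in
the right half of the box. -/
lemma measure_rect_le {α β p₁ : ℝ} (hα : 0 < α) (hα' : α ≤ 1) (hβ : 0 < β) (hβ' : β ≤ 1)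
    (hp₁ : 0 < p₁) (hp₁' : p₁ < 1) {ν : Measure (ℝ × ℝ)} [IsProbabilityMeasure ν]
    (hac : ν ≪ volume) (hbox : ν unitBoxᶜ = 0)
    (hinv : ∀ A : Set (ℝ × ℝ), MeasurableSet A → ν (skewLSV α β p₁ ⁻¹' A) = ν A)
    {a b c d : ℝ} (ha : 1 / 2 ≤ a) (hab : a ≤ b) (hb : b ≤ 1) (hc : 0 ≤ c) (hcd : c ≤ d)
    (hd : d ≤ 1) :
    ν (Ioc a b ×ˢ Ico c d) ≤ 2 * volume (Ioc a b ×ˢ Ico c d) := by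
  set Q : Set (ℝ × ℝ) := Ioc a b ×ˢ Ico c d with hQ
  have hQm : MeasurableSet Q := measurableSet_Ioc.prod measurableSet_Ico
  have hQ1 : volume Q ≤ 1 := by
    rw [hQ, Measure.volume_eq_prod, Measure.prod_prod, Real.volume_Ioc, Real.volume_Ico]
    refine mul_le_one' ?_ ?_ <;> rw [ENNReal.ofReal_le_one] <;> linarith
  refine ENNReal.le_of_forall_pos_le_add fun ε' hε' _ => ?_
  set ε : NNReal := ε' / 5 with hε
  have hε0 : 0 < ε := by positivity
  obtain ⟨g, hgs, hgc, hgν, hg1⟩ := exists_continuous_density_approx hac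
    (ε := ε) (by exact_mod_cast hε0.ne')
  have huc := hgs.uniformContinuous_of_continuous hgc
  obtain ⟨δ, hδ, hgδ⟩ := Metric.uniformContinuous_iff.1 huc ε (by exact_mod_cast hε0)
  obtain ⟨n, hn1, hn2⟩ : ∃ n : ℕ, 1 / ((n : ℝ) + 1) < δ ∧ max p₁ (1 - p₁) ^ n < δ := by
    have h1 := tendsto_one_div_add_atTop_nhds_zero_nat (𝕜 := ℝ)
    have h2 := tendsto_pow_atTop_nhds_zero_of_lt_one (le_max_of_le_left hp₁.le)
      (max_lt hp₁' (by linarith) : max p₁ (1 - p₁) < 1)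
    exact ((h1.eventually_lt_const hδ).and (h2.eventually_lt_const hδ)).exists
  set J : (Fin n → Bool × Bool) → Set (ℝ × ℝ) := fun w =>
    itineraryCylinder α β p₁ n (extendWord w) with hJ
  have hJm : ∀ w, MeasurableSet (J w) := fun w => measurableSet_itineraryCylinder _ _ _ _ _
  have hJd : Pairwise (Function.onFun Disjoint J) := pairwise_disjoint_itineraryCylinder α β p₁ n
  have hclose : ∀ w, ∀ p ∈ J w, ∀ q ∈ J w, ‖g p‖ₑ ≤ ‖g q‖ₑ + ε := by
    intro w p hp q hq
    obtain ⟨h1, h2⟩ := abs_sub_le_of_same_itinerary hα hα' hβ hβ' hp₁ hp₁' n hp.1 hq.1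
      fun k hk => (hp.2 k hk).trans (hq.2 k hk).symm
    have hdist : dist p q < δ := by
      rw [Prod.dist_eq, Real.dist_eq, Real.dist_eq]
      exact max_lt (h1.trans_lt hn1) (h2.trans_lt hn2)
    have h3 := hgδ hdist
    rw [dist_eq_norm] at h3
    calc ‖g p‖ₑ = ‖g q + (g p - g q)‖ₑ := by rw [add_sub_cancel]
      _ ≤ ‖g q‖ₑ + ‖g p - g q‖ₑ := enorm_add_le _ _
      _ ≤ ‖g q‖ₑ + ε := by
        gcongr
        rw [enorm_le_coe]
        exact_mod_cast h3.le
  set E : Set (ℝ × ℝ) := (skewLSV α β p₁)^[n] ⁻¹' Q with hE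
  have hEm : MeasurableSet E := ((measurable_skewLSV α β p₁).iterate n) hQm
  have hunion : unitBox ∩ E = ⋃ w, J w ∩ E := by
    rw [← iUnion_inter, hJ, iUnion_itineraryCylinder]
  have hcell : ∀ w, ∫⁻ p in J w ∩ E, ‖g p‖ₑ ≤
      2 * volume Q * ∫⁻ p in J w, (‖g p‖ₑ + ε) := by
    intro w
    set m : ENNReal := (⨅ q ∈ J w, ‖g q‖ₑ) + ε with hm
    have hm1 : ∀ p ∈ J w, ‖g p‖ₑ ≤ m := by
      intro p hp
      refine tsub_le_iff_right.1 (le_iInf₂ fun q hq => tsub_le_iff_right.2 ?_)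
      exact hclose w p hp q hq
    have hm2 : ∀ p ∈ J w, m ≤ ‖g p‖ₑ + ε := fun p hp => by
      rw [hm]
      gcongr
      exact iInf₂_le p hp
    calc ∫⁻ p in J w ∩ E, ‖g p‖ₑ ≤ ∫⁻ _ in J w ∩ E, m :=
          setLIntegral_mono' ((hJm w).inter hEm) fun p hp => hm1 p hp.1
      _ = m * volume (J w ∩ E) := setLIntegral_const _ _
      _ ≤ m * (2 * volume Q * volume (J w)) := by
        gcongr
        exact volume_cylinder_inter_le hα hβ hp₁ hp₁' n _ ha hab hb hc hcd hd
      _ = 2 * volume Q * ∫⁻ _ in J w, m := by rw [setLIntegral_const]; ring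
      _ ≤ _ := by
        gcongr 1
        exact setLIntegral_mono' (hJm w) hm2
  have hsum : ∫⁻ p in unitBox ∩ E, ‖g p‖ₑ ≤ 2 * volume Q * ∫⁻ p in unitBox, (‖g p‖ₑ + ε) := by
    rw [hunion, lintegral_iUnion (fun w => (hJm w).inter hEm)
      (fun w w' h => (hJd h).mono inter_subset_left inter_subset_left),
      ← iUnion_itineraryCylinder α β p₁ n, lintegral_iUnion hJm hJd, ← ENNReal.tsum_mul_left]
    exact ENNReal.tsum_le_tsum hcell
  have hbox1 : volume unitBox = 1 := by
    rw [unitBox, Measure.volume_eq_prod, Measure.prod_prod, Real.volume_Ioc, Real.volume_Ico]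
    simp
  have htot : ∫⁻ p in unitBox, (‖g p‖ₑ + ε) ≤ 1 + ε + ε := by
    rw [lintegral_add_right _ measurable_const, setLIntegral_const, hbox1, mul_one]
    gcongr
    exact (setLIntegral_le_lintegral _ _).trans (hg1.trans_eq (by rw [measure_univ]))
  calc ν Q = ν E := (measure_iterate_preimage (measurable_skewLSV α β p₁) hinv n hQm).symm
    _ ≤ ν (unitBox ∩ E) + ν unitBoxᶜ := by
      refine (measure_mono fun p hp => ?_).trans (measure_union_le _ _)
      by_cases h : p ∈ unitBox
      exacts [Or.inl ⟨h, hp⟩, Or.inr h]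
    _ = ν (unitBox ∩ E) := by rw [hbox, add_zero]
    _ ≤ (∫⁻ p in unitBox ∩ E, ‖g p‖ₑ) + ε := hgν _ (measurableSet_unitBox.inter hEm)
    _ ≤ 2 * volume Q * (1 + ε + ε) + ε := by
      gcongr
      exact hsum.trans (by gcongr)
    _ = 2 * volume Q + (2 * volume Q * (ε + ε) + ε) := by ring
    _ ≤ 2 * volume Q + (2 * 1 * (ε + ε) + ε) := by gcongr
    _ = 2 * volume Q + ε' := by
      congr 1
      rw [hε]
      norm_cast
      apply NNReal.eq
      push_cast
      ring

/-- An absolutely continuous invariant probability measure has density at most `2` on the right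
half of the box. -/
lemma restrict_right_half_le {α β p₁ : ℝ} (hα : 0 < α) (hα' : α ≤ 1) (hβ : 0 < β) (hβ' : β ≤ 1)
    (hp₁ : 0 < p₁) (hp₁' : p₁ < 1) {ν : Measure (ℝ × ℝ)} [IsProbabilityMeasure ν]
    (hac : ν ≪ volume) (hbox : ν unitBoxᶜ = 0)
    (hinv : ∀ A : Set (ℝ × ℝ), MeasurableSet A → ν (skewLSV α β p₁ ⁻¹' A) = ν A) :
    ν.restrict (Ioo (1 / 2) 1 ×ˢ Ioo 0 1) ≤
      ((2 : NNReal) • (volume : Measure (ℝ × ℝ))).restrict (Ioo (1 / 2) 1 ×ˢ Ioo 0 1) := by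
  refine Measure.le_iff.2 fun A hA => ?_
  rw [Measure.restrict_apply hA, Measure.restrict_apply hA]
  refine (Besicovitch.vitaliFamily (volume : Measure (ℝ × ℝ))).measure_le_of_frequently_le _ hac _ ?_
  rintro ⟨x, y⟩ ⟨-, hx, hy⟩
  refine (Besicovitch.tendsto_filterAt volume (x, y)).frequently (Eventually.frequently ?_)
  have hr : 0 < min (min (x - 1 / 2) (1 - x)) (min y (1 - y)) := by
    simp only [lt_min_iff, sub_pos]
    exact ⟨hx, hy⟩
  filter_upwards [Ioo_mem_nhdsGT hr] with r ⟨hr0, hr⟩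
  simp only [lt_min_iff] at hr
  obtain ⟨⟨h1, h2⟩, h3, h4⟩ := hr
  have hball : Metric.closedBall (x, y) r =ᵐ[volume] Ioc (x - r) (x + r) ×ˢ Ico (y - r) (y + r) := by
    rw [← closedBall_prod_same, Real.closedBall_eq_Icc, Real.closedBall_eq_Icc,
      Measure.volume_eq_prod]
    exact Measure.set_prod_ae_eq Ioc_ae_eq_Icc.symm Ico_ae_eq_Icc.symm
  rw [measure_congr (hac.ae_eq hball), Measure.smul_apply, measure_congr hball]
  exact measure_rect_le hα hα' hβ hβ' hp₁ hp₁' hac hbox hinv (by linarith) (by linarith)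
    (by linarith) (by linarith) (by linarith) (by linarith)

/-- Time needed to enter the right half of the box, counting both endpoints and truncated
after `n` steps. -/
def truncTime (α β p₁ : ℝ) : ℕ → ℝ × ℝ → ENNReal
  | 0, _ => 0
  | n + 1, p => if p.1 ≤ 1 / 2 then 1 + truncTime α β p₁ n (skewLSV α β p₁ p) else 1

lemma measurable_truncTime (α β p₁ : ℝ) (n : ℕ) : Measurable (truncTime α β p₁ n) := by
  induction n with
  | zero => exact measurable_const
  | succ n ih =>
    exact Measurable.ite (measurableSet_le measurable_fst measurable_const)
      ((ih.comp (measurable_skewLSV α β p₁)).const_add 1) measurable_const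

lemma monotone_truncTime (α β p₁ : ℝ) (p : ℝ × ℝ) : Monotone fun n => truncTime α β p₁ n p := by
  refine monotone_nat_of_le_succ fun n => ?_
  induction n generalizing p with
  | zero => exact zero_le
  | succ n ih =>
    rw [truncTime, truncTime]
    split_ifs
    · gcongr
      exact ih _
    · exact le_rfl

lemma succ_le_truncTime {α β p₁ : ℝ} (hα : 0 < α) (hβ : 0 < β) (hp₁ : 0 < p₁) (m : ℕ) {p : ℝ × ℝ}
    (hp : p ∈ unitBox) (h : ∀ k < m, (skewLSV α β p₁)^[k] p ∉ Δ0) :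
    ((m + 1 : ℕ) : ENNReal) ≤ truncTime α β p₁ (m + 1) p := by
  induction m generalizing p with
  | zero =>
    rw [truncTime]
    split_ifs <;> simp
  | succ m ih =>
    have hle : p.1 ≤ 1 / 2 := by
      by_contra! hlt
      exact h 0 (by omega) ⟨⟨hlt, hp.1.2⟩, hp.2.1, hp.2.2.le⟩
    rw [truncTime, if_pos hle]
    have := ih (skewLSV_mem_unitBox hα hβ hp₁ hp) fun k hk => by
      simpa only [← Function.iterate_succ_apply] using h (k + 1) (by omega)
    rw [Nat.cast_succ, add_comm]
    gcongr

lemma retTime_le_truncTime {α β p₁ : ℝ} (hα : 0 < α) (hβ : 0 < β) (hp₁ : 0 < p₁) {p : ℝ × ℝ}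
    (hp : p ∈ unitBox) :
    (retTime α β p₁ p : ENNReal) ≤
      truncTime α β p₁ (retTime α β p₁ p) (skewLSV α β p₁ p) := by
  rcases h : retTime α β p₁ p with _ | m
  · simp
  · refine succ_le_truncTime hα hβ hp₁ m (skewLSV_mem_unitBox hα hβ hp₁ hp) fun k hk hmem => ?_
    rw [← Function.iterate_succ_apply] at hmem
    have hlt : k + 1 < retTime α β p₁ p := by omega
    exact Nat.notMem_of_lt_sInf hlt ⟨by omega, hmem⟩

lemma lintegral_Ico_affine {r s : ℝ} (hs : 0 < s) (g : ℝ → ENNReal) :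
    ∫⁻ x in Ico r (r + s), g ((x - r) / s) = ENNReal.ofReal s * ∫⁻ x in Ico (0 : ℝ) 1, g x := by
  have himg : (fun x => r + s * x) '' Ico (0 : ℝ) 1 = Ico r (r + s) := by
    ext x
    constructor
    · rintro ⟨y, ⟨h1, h2⟩, rfl⟩
      constructor <;> dsimp <;> nlinarith
    · rintro ⟨h1, h2⟩
      refine ⟨(x - r) / s, ⟨div_nonneg (by linarith) hs.le, ?_⟩, by field_simp; ring⟩
      rw [div_lt_one hs]
      linarith
  have hderiv : ∀ x ∈ Ico (0 : ℝ) 1,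
      HasDerivWithinAt (fun x => r + s * x) s (Ico (0 : ℝ) 1) x := fun x _ => by
    simpa using (((hasDerivAt_id x).const_mul s).const_add r).hasDerivWithinAt
  have hinj : InjOn (fun x => r + s * x) (Ico (0 : ℝ) 1) := fun x _ y _ h => by
    simpa [hs.ne'] using h
  rw [← himg, lintegral_image_eq_lintegral_abs_deriv_mul measurableSet_Ico hderiv hinj,
    abs_of_pos hs, lintegral_const_mul' _ _ ENNReal.ofReal_ne_top]
  congr 1
  refine lintegral_congr fun x => ?_
  congr 1
  field_simp
  ring

/-- The parameter and the updated noise are independent, and the updated noise is uniform. -/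
lemma lintegral_noise {p₁ : ℝ} (hp₁ : 0 < p₁) (hp₁' : p₁ < 1) (α β : ℝ) (H : ℝ → ℝ → ENNReal) :
    ∫⁻ w in Ico (0 : ℝ) 1, H (alphaOf α β p₁ w) (phiMap p₁ w) =
      ENNReal.ofReal p₁ * (∫⁻ w in Ico (0 : ℝ) 1, H α w) +
        ENNReal.ofReal (1 - p₁) * ∫⁻ w in Ico (0 : ℝ) 1, H β w := by
  have h1 := lintegral_Ico_affine (r := 0) hp₁ (H α)
  have h2 := lintegral_Ico_affine (r := p₁) (sub_pos.2 hp₁') (H β)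
  rw [zero_add] at h1
  rw [add_sub_cancel] at h2
  rw [← h1, ← h2, ← Ico_union_Ico_eq_Ico hp₁.le hp₁'.le,
    lintegral_union measurableSet_Ico (Set.disjoint_left.2 fun x hx hx' => not_le.2 hx.2 hx'.1)]
  congr 1
  · refine setLIntegral_congr_fun measurableSet_Ico fun x hx => ?_
    simp [alphaOf, phiMap, hx.2]
  · refine setLIntegral_congr_fun measurableSet_Ico fun x hx => ?_
    simp [alphaOf, phiMap, not_lt.2 hx.1]

lemma rpow_neg_lsv_le {a b x : ℝ} (ha : 0 < a) (hb : 0 ≤ b) (hb' : b ≤ 1) (hx : 0 < x)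
    (hx' : x ≤ 1 / 2) : lsv a x ^ (-b) ≤ x ^ (-b) - b / 2 * x ^ (a - b) := by
  set s := (2 : ℝ) ^ a * x ^ a with hs
  have hs0 : 0 ≤ s := by positivity
  have hs1 : s ≤ 1 := by
    rw [hs, ← Real.mul_rpow (by norm_num) hx.le]
    exact Real.rpow_le_one (by linarith) (by linarith) ha.le
  have hxs : x ^ a ≤ s :=
    le_mul_of_one_le_left (by positivity) (Real.one_le_rpow (by norm_num) ha.le)
  have h1 : (1 + s) ^ (-b) ≤ 1 - b / 2 * s := by
    have hinv : (1 + s)⁻¹ ≤ 1 + -(s / 2) := by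
      rw [inv_le_iff_one_le_mul₀ (by linarith)]
      nlinarith
    rw [Real.rpow_neg (by linarith), ← Real.inv_rpow (by linarith)]
    calc (1 + s)⁻¹ ^ b ≤ (1 + -(s / 2)) ^ b :=
          Real.rpow_le_rpow (inv_nonneg.2 (by linarith)) hinv hb
      _ ≤ 1 + b * -(s / 2) := rpow_one_add_le_one_add_mul_self (by linarith) hb hb'
      _ = _ := by ring
  rw [lsv, if_pos hx', Real.mul_rpow hx.le (by linarith), sub_eq_add_neg a b, Real.rpow_add hx]
  have h2 := mul_le_mul_of_nonneg_left h1 (by positivity : 0 ≤ x ^ (-b))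
  have h3 := mul_le_mul_of_nonneg_left hxs (by positivity : 0 ≤ x ^ (-b) * (b / 2))
  linarith

lemma ofReal_weighted_add_le {p u v A B C : ℝ} {U V : ENNReal} (hp : 0 ≤ p) (hp' : p ≤ 1)
    (hu : U ≤ ENNReal.ofReal (C * u)) (hv : V ≤ ENNReal.ofReal (C * v)) (hu0 : 0 ≤ C * u)
    (hv0 : 0 ≤ C * v) (hA : 0 ≤ A) (h : A + (p * (C * u) + (1 - p) * (C * v)) ≤ B) :
    ENNReal.ofReal A + (ENNReal.ofReal p * U + ENNReal.ofReal (1 - p) * V) ≤ ENNReal.ofReal B := by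
  have hp2 : 0 ≤ 1 - p := by linarith
  have hpu := mul_nonneg hp hu0
  have hpv := mul_nonneg hp2 hv0
  calc _ ≤ ENNReal.ofReal A + (ENNReal.ofReal p * ENNReal.ofReal (C * u) +
        ENNReal.ofReal (1 - p) * ENNReal.ofReal (C * v)) := by gcongr
    _ = ENNReal.ofReal (A + (p * (C * u) + (1 - p) * (C * v))) := by
      rw [← ENNReal.ofReal_mul hp, ← ENNReal.ofReal_mul hp2, ← ENNReal.ofReal_add hpu hpv,
        ← ENNReal.ofReal_add hA (add_nonneg hpu hpv)]
    _ ≤ _ := ENNReal.ofReal_le_ofReal h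

lemma rpow_neg_lsv_le_self {a b x : ℝ} (ha : 0 < a) (hb : 0 ≤ b) (hb' : b ≤ 1) (hx : 0 < x)
    (hx' : x ≤ 1 / 2) : lsv a x ^ (-b) ≤ x ^ (-b) := by
  refine (rpow_neg_lsv_le ha hb hb' hx hx').trans (sub_le_self _ ?_)
  positivity

lemma volume_restrict_Ico_lintegral_one : ∫⁻ _ in Ico (0 : ℝ) 1, (1 : ENNReal) = 1 := by
  simp

/-- First moment bound for the truncated entrance time, on each fibre. -/
lemma lintegral_truncTime_le {α β p₁ : ℝ} (hα : 0 < α) (hα' : α ≤ 1) (hβ : 0 < β) (hp₁ : 0 < p₁)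
    (hp₁' : p₁ < 1) (n : ℕ) {x : ℝ} (hx : x ∈ Ioc (0 : ℝ) 1) :
    ∫⁻ w in Ico (0 : ℝ) 1, truncTime α β p₁ n (x, w) ≤
      ENNReal.ofReal (2 / (α * p₁) * x ^ (-α)) := by
  induction n generalizing x with
  | zero => simp [truncTime]
  | succ n ih =>
    have hαp : α * p₁ ≤ 1 := mul_le_one₀ hα' hp₁.le hp₁'.le
    have hK : 1 ≤ 2 / (α * p₁) := by
      rw [le_div_iff₀ (by positivity)]
      linarith
    by_cases hx' : x ≤ 1 / 2
    · have hTα := lsv_mem_Ioc hα hx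
      have hTβ := lsv_mem_Ioc hβ hx
      have hTα0 := hTα.1
      have hTβ0 := hTβ.1
      simp only [truncTime, if_pos hx']
      rw [lintegral_add_left measurable_const, volume_restrict_Ico_lintegral_one]
      simp only [skewLSV]
      rw [lintegral_noise hp₁ hp₁' α β fun a w => truncTime α β p₁ n (lsv a x, w),
        ← ENNReal.ofReal_one]
      refine ofReal_weighted_add_le hp₁.le hp₁'.le (ih hTα) (ih hTβ) (by positivity)
        (by positivity) zero_le_one ?_
      have h1 := rpow_neg_lsv_le hα hα.le hα' hx.1 hx'
      have h2 := rpow_neg_lsv_le_self hβ hα.le hα' hx.1 hx'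
      rw [sub_self, Real.rpow_zero] at h1
      have h3 : p₁ * (2 / (α * p₁) * (α / 2)) = 1 := by field_simp
      have h4 := mul_le_mul_of_nonneg_left h1 (by positivity : 0 ≤ p₁ * (2 / (α * p₁)))
      have h5 := mul_le_mul_of_nonneg_left h2
        (mul_nonneg (sub_nonneg.2 hp₁'.le) (by positivity) : 0 ≤ (1 - p₁) * (2 / (α * p₁)))
      linarith
    · simp only [truncTime, if_neg hx']
      rw [volume_restrict_Ico_lintegral_one, ← ENNReal.ofReal_one]
      refine ENNReal.ofReal_le_ofReal (one_le_mul_of_one_le_of_one_le hK ?_)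
      exact Real.one_le_rpow_of_pos_of_le_one_of_nonpos hx.1 hx.2 (by linarith)

/-- Second moment bound for the truncated entrance time, on each fibre. -/
lemma lintegral_truncTime_sq_le {α β p₁ : ℝ} (hα : 0 < α) (hα' : 2 * α ≤ 1) (hβ : 0 < β)
    (hp₁ : 0 < p₁) (hp₁' : p₁ < 1) (n : ℕ) {x : ℝ} (hx : x ∈ Ioc (0 : ℝ) 1) :
    ∫⁻ w in Ico (0 : ℝ) 1, truncTime α β p₁ n (x, w) ^ 2 ≤
      ENNReal.ofReal ((1 + 2 * (2 / (α * p₁))) / (α * p₁) * x ^ (-(2 * α))) := by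
  induction n generalizing x with
  | zero => simp [truncTime]
  | succ n ih =>
    set K := 2 / (α * p₁) with hK
    have hK0 : 0 < K := by positivity
    have hαp : α * p₁ ≤ 1 := mul_le_one₀ (by linarith) hp₁.le hp₁'.le
    have hL : 1 ≤ (1 + 2 * K) / (α * p₁) := by
      rw [le_div_iff₀ (by positivity)]
      linarith
    set L := (1 + 2 * K) / (α * p₁) with hL'
    by_cases hx' : x ≤ 1 / 2
    · have hTα := lsv_mem_Ioc hα hx
      have hTβ := lsv_mem_Ioc hβ hx
      have hTα0 := hTα.1
      have hTβ0 := hTβ.1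
      have hx0 := hx.1
      have hmS : Measurable fun w => truncTime α β p₁ n (skewLSV α β p₁ (x, w)) :=
        (measurable_truncTime α β p₁ n).comp ((measurable_skewLSV α β p₁).comp
          measurable_prodMk_left)
      have hfirst : ∫⁻ w in Ico (0 : ℝ) 1, truncTime α β p₁ n (skewLSV α β p₁ (x, w)) ≤
          ENNReal.ofReal (K * x ^ (-α)) := by
        simp only [skewLSV]
        rw [lintegral_noise hp₁ hp₁' α β fun a w => truncTime α β p₁ n (lsv a x, w)]
        have h := ofReal_weighted_add_le (A := 0) (B := K * x ^ (-α)) hp₁.le hp₁'.le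
          (lintegral_truncTime_le hα (by linarith) hβ hp₁ hp₁' n hTα)
          (lintegral_truncTime_le hα (by linarith) hβ hp₁ hp₁' n hTβ) (by positivity)
          (by positivity) le_rfl ?_
        · simpa using h
        · have h1 := mul_le_mul_of_nonneg_left
            (rpow_neg_lsv_le_self hα hα.le (by linarith) hx.1 hx') (by positivity : 0 ≤ p₁ * K)
          have h2 := mul_le_mul_of_nonneg_left
            (rpow_neg_lsv_le_self hβ hα.le (by linarith) hx.1 hx')
            (mul_nonneg (sub_nonneg.2 hp₁'.le) hK0.le)
          linarith
      have hsplit : ∫⁻ w in Ico (0 : ℝ) 1, truncTime α β p₁ (n + 1) (x, w) ^ 2 =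
          (1 + 2 * ∫⁻ w in Ico (0 : ℝ) 1, truncTime α β p₁ n (skewLSV α β p₁ (x, w))) +
            ∫⁻ w in Ico (0 : ℝ) 1, truncTime α β p₁ n (skewLSV α β p₁ (x, w)) ^ 2 := by
        rw [← lintegral_const_mul _ hmS]
        nth_rewrite 1 [← volume_restrict_Ico_lintegral_one]
        have hmR : Measurable fun w =>
            1 + 2 * truncTime α β p₁ n (skewLSV α β p₁ (x, w)) := (hmS.const_mul 2).const_add 1
        rw [← lintegral_add_left measurable_const, ← lintegral_add_left hmR]
        refine lintegral_congr fun w => ?_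
        rw [truncTime, if_pos hx']
        ring
      have hone : 1 + 2 * (∫⁻ w in Ico (0 : ℝ) 1, truncTime α β p₁ n (skewLSV α β p₁ (x, w))) ≤
          ENNReal.ofReal (1 + 2 * (K * x ^ (-α))) := by
        rw [ENNReal.ofReal_add zero_le_one (by positivity), ENNReal.ofReal_one,
          ENNReal.ofReal_mul zero_le_two, ENNReal.ofReal_ofNat]
        gcongr
      rw [hsplit]
      refine (add_le_add_left hone _).trans ?_
      simp only [skewLSV]
      rw [lintegral_noise hp₁ hp₁' α β fun a w => truncTime α β p₁ n (lsv a x, w) ^ 2]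
      refine ofReal_weighted_add_le hp₁.le hp₁'.le (ih hTα) (ih hTβ) (by positivity)
        (by positivity) (by positivity) ?_
      have h1 := rpow_neg_lsv_le hα (by linarith : 0 ≤ 2 * α) hα' hx.1 hx'
      have h2 := rpow_neg_lsv_le_self hβ (by linarith : 0 ≤ 2 * α) hα' hx.1 hx'
      rw [show α - 2 * α = -α by ring] at h1
      have h3 : p₁ * L * (2 * α / 2) = 1 + 2 * K := by
        rw [hL']
        field_simp
      have h4 := mul_le_mul_of_nonneg_left h1 (by positivity : 0 ≤ p₁ * L)
      have h5 := mul_le_mul_of_nonneg_left h2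
        (mul_nonneg (sub_nonneg.2 hp₁'.le) (by positivity) : 0 ≤ (1 - p₁) * L)
      have h6 : 1 ≤ x ^ (-α) :=
        Real.one_le_rpow_of_pos_of_le_one_of_nonpos hx.1 hx.2 (by linarith)
      have h7 : p₁ * L * (2 * α / 2 * x ^ (-α)) = (1 + 2 * K) * x ^ (-α) := by
        rw [← h3]
        ring
      linarith
    · simp only [truncTime, if_neg hx', one_pow]
      rw [volume_restrict_Ico_lintegral_one, ← ENNReal.ofReal_one]
      refine ENNReal.ofReal_le_ofReal (one_le_mul_of_one_le_of_one_le hL ?_)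
      exact Real.one_le_rpow_of_pos_of_le_one_of_nonpos hx.1 hx.2 (by linarith)

lemma lintegral_rpow_two_mul_sub_one_lt_top {r : ℝ} (hr : -1 < r) (K : ℝ) :
    ∫⁻ x in Ioc (1 / 2 : ℝ) 1, ENNReal.ofReal (K * (2 * x - 1) ^ r) < ⊤ := by
  have h := ((intervalIntegral.intervalIntegrable_rpow' (a := 0) (b := 1) hr).const_mul K)
  have h2 := (h.comp_mul_left (c := 2)).comp_sub_right (1 / 2)
  norm_num at h2
  rw [intervalIntegrable_iff_integrableOn_Ioc_of_le (by norm_num)] at h2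
  have h3 := h2.lintegral_lt_top
  refine lt_of_eq_of_lt (lintegral_congr fun x => ?_) h3
  congr 4
  ring

/-- The second moment of the truncated return time on the right half of the box is bounded
uniformly in the truncation. -/
lemma exists_lintegral_truncTime_sq_le {α β p₁ : ℝ} (hα : 0 < α) (hα' : α < 1 / 2) (hβ : 0 < β)
    (hp₁ : 0 < p₁) (hp₁' : p₁ < 1) :
    ∃ C : ENNReal, C < ⊤ ∧ ∀ n, ∫⁻ p in Ioc (1 / 2 : ℝ) 1 ×ˢ Ico (0 : ℝ) 1,
      truncTime α β p₁ n (skewLSV α β p₁ p) ^ 2 ≤ C := by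
  refine ⟨_, lintegral_rpow_two_mul_sub_one_lt_top (r := -(2 * α)) (by linarith)
    ((1 + 2 * (2 / (α * p₁))) / (α * p₁)), fun n => ?_⟩
  have hm : Measurable fun p => truncTime α β p₁ n (skewLSV α β p₁ p) ^ 2 :=
    ((measurable_truncTime α β p₁ n).comp (measurable_skewLSV α β p₁)).pow_const 2
  rw [Measure.volume_eq_prod, ← Measure.prod_restrict, lintegral_prod _ hm.aemeasurable]
  refine setLIntegral_mono' measurableSet_Ioc fun x hx => ?_
  have hx1 := hx.1
  have hx2 := hx.2
  simp only [skewLSV, lsv_of_gt hx.1]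
  rw [lintegral_noise hp₁ hp₁' α β fun _ w => truncTime α β p₁ n (2 * x - 1, w) ^ 2,
    ← add_mul, ← ENNReal.ofReal_add hp₁.le (by linarith), add_sub_cancel, ENNReal.ofReal_one,
    one_mul]
  exact lintegral_truncTime_sq_le hα (by linarith) hβ hp₁ hp₁' n ⟨by linarith, by linarith⟩

lemma abs_inducedObs_sq_le {α β p₁ : ℝ} (hα : 0 < α) (hβ : 0 < β) (hp₁ : 0 < p₁)
    {f : ℝ × ℝ → ℝ} {M : ℝ} (hM : ∀ p ∈ unitBox, |f p| ≤ M) {p : ℝ × ℝ} (hp : p ∈ unitBox) :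
    ENNReal.ofReal (|inducedObs α β p₁ f p| ^ 2) ≤
      ENNReal.ofReal (M ^ 2) * ⨆ n, truncTime α β p₁ n (skewLSV α β p₁ p) ^ 2 := by
  have h1 : |inducedObs α β p₁ f p| ≤ retTime α β p₁ p * M := by
    refine (Finset.abs_sum_le_sum_abs _ _).trans ?_
    refine (Finset.sum_le_card_nsmul _ _ M fun k _ => ?_).trans_eq ?_
    · exact hM _ (iterate_skewLSV_mem_unitBox hα hβ hp₁ hp k)
    · simp
  calc ENNReal.ofReal (|inducedObs α β p₁ f p| ^ 2)
      ≤ ENNReal.ofReal ((retTime α β p₁ p * M) ^ 2) := by gcongr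
    _ = ENNReal.ofReal (M ^ 2) * (retTime α β p₁ p : ENNReal) ^ 2 := by
      rw [mul_pow, mul_comm, ENNReal.ofReal_mul (sq_nonneg M),
        ENNReal.ofReal_pow (Nat.cast_nonneg _), ENNReal.ofReal_natCast]
    _ ≤ ENNReal.ofReal (M ^ 2) *
        truncTime α β p₁ (retTime α β p₁ p) (skewLSV α β p₁ p) ^ 2 := by
      gcongr
      exact retTime_le_truncTime hα hβ hp₁ hp
    _ ≤ _ := by
      gcongr
      exact le_iSup (fun n => truncTime α β p₁ n (skewLSV α β p₁ p) ^ 2) _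

lemma exists_bound_of_holder {f : ℝ × ℝ → ℝ}
    (hf : ∃ C t : ℝ, 0 < t ∧ t ≤ 1 ∧
      ∀ p ∈ Icc (0 : ℝ) 1 ×ˢ Icc (0 : ℝ) 1, ∀ q ∈ Icc (0 : ℝ) 1 ×ˢ Icc (0 : ℝ) 1,
        |f p - f q| ≤ C * dist p q ^ t) :
    ∃ M : ℝ, ∀ p ∈ unitBox, |f p| ≤ M := by
  obtain ⟨C, t, ht, -, h⟩ := hf
  refine ⟨|f 0| + |C|, fun p hp => ?_⟩
  obtain ⟨⟨h1, h2⟩, h3, h4⟩ := hp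
  have h0 := h p ⟨⟨h1.le, h2⟩, h3, h4.le⟩ 0 ⟨⟨le_rfl, zero_le_one⟩, le_rfl, zero_le_one⟩
  have hd : dist p 0 ≤ 1 := by
    rw [Prod.dist_eq, Real.dist_eq, Real.dist_eq]
    simp only [Prod.fst_zero, Prod.snd_zero, sub_zero]
    rw [abs_of_pos h1, abs_of_nonneg h3]
    exact max_le h2 h4.le
  have hdt : dist p 0 ^ t ≤ 1 := Real.rpow_le_one dist_nonneg hd ht.le
  have h5 : C * dist p 0 ^ t ≤ |C| * 1 :=
    mul_le_mul (le_abs_self C) hdt (by positivity) (abs_nonneg C)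
  have h6 : |f p| ≤ |f p - f 0| + |f 0| := by simpa using abs_add_le (f p - f 0) (f 0)
  linarith

/-- Lemma 3.4: for `0 < α < 1/2`, `f_{Δ₀} ∈ L²(Δ₀, ν)` for Hölder `f`. -/
theorem induced_obs_L2 (α β p₁ : ℝ) (hα : 0 < α) (hα2 : α < 1 / 2) (hαβ : α < β) (hβ : β < 1)
    (hp₁ : 0 < p₁) (hp₁' : p₁ < 1)
    (ν : Measure (ℝ × ℝ)) (hprob : IsProbabilityMeasure ν)
    (hac : ν ≪ (volume : Measure (ℝ × ℝ)))
    (hsupp : ν ((Icc (0 : ℝ) 1 ×ˢ Icc (0 : ℝ) 1)ᶜ) = 0)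
    (hinv : ∀ A : Set (ℝ × ℝ), MeasurableSet A → ν (skewLSV α β p₁ ⁻¹' A) = ν A)
    (f : ℝ × ℝ → ℝ)
    (hf : ∃ C t : ℝ, 0 < t ∧ t ≤ 1 ∧
      ∀ p ∈ Icc (0 : ℝ) 1 ×ˢ Icc (0 : ℝ) 1, ∀ q ∈ Icc (0 : ℝ) 1 ×ˢ Icc (0 : ℝ) 1,
        |f p - f q| ≤ C * dist p q ^ t) :
    (∫⁻ p in Δ0, ENNReal.ofReal (|inducedObs α β p₁ f p| ^ 2) ∂ν) < ⊤ := by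
  have hβ0 : 0 < β := hα.trans hαβ
  have hbox : ν unitBoxᶜ = 0 := by
    rw [← measure_congr (hac.ae_eq unitBox_ae_eq).compl]
    exact hsupp
  obtain ⟨M, hM⟩ := exists_bound_of_holder hf
  obtain ⟨C, hC, hτ⟩ := exists_lintegral_truncTime_sq_le hα hα2 hβ0 hp₁ hp₁'
  set D : Set (ℝ × ℝ) := Ioo (1 / 2 : ℝ) 1 ×ˢ Ioo (0 : ℝ) 1 with hD
  have hDm : MeasurableSet D := measurableSet_Ioo.prod measurableSet_Ioo
  have hDae : Δ0 =ᵐ[ν] D := by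
    refine hac.ae_eq ?_
    rw [Measure.volume_eq_prod]
    exact Measure.set_prod_ae_eq Ioo_ae_eq_Ioc.symm Ioo_ae_eq_Icc.symm
  have hDsub : D ⊆ Ioc (1 / 2 : ℝ) 1 ×ˢ Ico (0 : ℝ) 1 :=
    prod_mono Ioo_subset_Ioc_self Ioo_subset_Ico_self
  have hmeas : ∀ n, Measurable fun p => truncTime α β p₁ n (skewLSV α β p₁ p) ^ 2 := fun n =>
    ((measurable_truncTime α β p₁ n).comp (measurable_skewLSV α β p₁)).pow_const 2
  calc ∫⁻ p in Δ0, ENNReal.ofReal (|inducedObs α β p₁ f p| ^ 2) ∂ν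
      = ∫⁻ p in D, ENNReal.ofReal (|inducedObs α β p₁ f p| ^ 2) ∂ν := setLIntegral_congr hDae
    _ ≤ ∫⁻ p in D, ENNReal.ofReal (|inducedObs α β p₁ f p| ^ 2)
          ∂((2 : NNReal) • (volume : Measure (ℝ × ℝ))) :=
      lintegral_mono' (restrict_right_half_le hα (by linarith) hβ0 hβ.le hp₁ hp₁' hac hbox hinv)
        le_rfl
    _ = 2 * ∫⁻ p in D, ENNReal.ofReal (|inducedObs α β p₁ f p| ^ 2) := by
      rw [Measure.restrict_smul, lintegral_smul_measure]
      rfl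
    _ ≤ 2 * ∫⁻ p in D, ENNReal.ofReal (M ^ 2) *
          ⨆ n, truncTime α β p₁ n (skewLSV α β p₁ p) ^ 2 := by
      gcongr 1
      refine setLIntegral_mono' hDm fun p hp => abs_inducedObs_sq_le hα hβ0 hp₁ hM ?_
      exact ⟨⟨by linarith [hp.1.1], hp.1.2.le⟩, hp.2.1.le, hp.2.2⟩
    _ = 2 * (ENNReal.ofReal (M ^ 2) *
          ⨆ n, ∫⁻ p in D, truncTime α β p₁ n (skewLSV α β p₁ p) ^ 2) := by
      rw [lintegral_const_mul' _ _ ENNReal.ofReal_ne_top, lintegral_iSup hmeas]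
      intro m n hmn p
      exact pow_le_pow_left₀ zero_le (monotone_truncTime α β p₁ _ hmn) 2
    _ ≤ 2 * (ENNReal.ofReal (M ^ 2) * C) := by
      gcongr
      exact iSup_le fun n => (lintegral_mono_set hDsub).trans (hτ n)
    _ < ⊤ := ENNReal.mul_lt_top (by simp) (ENNReal.mul_lt_top ENNReal.ofReal_lt_top hC)
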